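/- In the setting of the abstract DEC inf-sup theorem (finite-dimensional real inner product spaces V⁰, V¹, V² with d⁰ : V⁰ → V¹, d¹ : V¹ → V², d¹∘d⁰ = 0, graph norms ‖·‖_V, harmonic space H = ker d¹ ∩ (range d⁰)^⊥, Poincaré constant c_P, symmetric positive-definite bilinear forms D⁰, D¹, D² with |Dⁱ(u,w) − ⟨u,w⟩| ≤ ε·‖u‖_V·‖w‖_V, and DEC bilinear form B_D), define also B_F by the same formula with the inner products ⟨·,·⟩ in place of Dⁱ. Let f ∈ V¹, let (σ, u, p) ∈ V⁰ × V¹ × H satisfy B_F(σ, u, p; τ, v, q) = ⟨f, v⟩ for all (τ, v, q) ∈ V⁰ × V¹ × H, and let (σ̂, û, p̂) ∈ V⁰ × V¹ × H satisfy B_D(σ̂, û, p̂; τ, v, q) = D¹(f, v) for all (τ, v, q) ∈ V⁰ × V¹ × H. Then there exist constants C' > 0 and ε₀ > 0 depending only on c_P such that whenever ε ≤ ε₀, ‖σ̂ − σ‖_V + ‖û − u‖_V + ‖p̂ − p‖ ≤ C'·ε·( ‖σ‖_V + ‖u‖_V + ‖p‖ + ‖f‖_V ). -/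

import Mathlib

open scoped RealInnerProductSpace

/-- The graph norm of `x` with respect to the linear operator `d`. -/
noncomputable def graphNorm {V W : Type*} [NormedAddCommGroup V] [InnerProductSpace ℝ V]
    [NormedAddCommGroup W] [InnerProductSpace ℝ W] (d : V →ₗ[ℝ] W) (x : V) : ℝ :=
  Real.sqrt (‖x‖ ^ 2 + ‖d x‖ ^ 2)

section GraphNorm

variable {V W : Type*} [NormedAddCommGroup V] [InnerProductSpace ℝ V]
  [NormedAddCommGroup W] [InnerProductSpace ℝ W] (d : V →ₗ[ℝ] W)

lemma graphNorm_def (x : V) : graphNorm d x = Real.sqrt (‖x‖ ^ 2 + ‖d x‖ ^ 2) := rfl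

lemma graphNorm_nonneg (x : V) : 0 ≤ graphNorm d x := Real.sqrt_nonneg _

lemma norm_le_graphNorm (x : V) : ‖x‖ ≤ graphNorm d x :=
  Real.le_sqrt_of_sq_le (by nlinarith [sq_nonneg ‖d x‖])

lemma norm_map_le_graphNorm (x : V) : ‖d x‖ ≤ graphNorm d x :=
  Real.le_sqrt_of_sq_le (by nlinarith [sq_nonneg ‖x‖])

lemma graphNorm_le_add (x : V) : graphNorm d x ≤ ‖x‖ + ‖d x‖ :=
  (Real.sqrt_le_left (by positivity)).2
    (by nlinarith [mul_nonneg (norm_nonneg x) (norm_nonneg (d x))])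

lemma graphNorm_of_map_eq_zero {x : V} (hx : d x = 0) : graphNorm d x = ‖x‖ := by
  simp [graphNorm, hx]

lemma graphNorm_add_le (x y : V) : graphNorm d (x + y) ≤ graphNorm d x + graphNorm d y := by
  have key (z : V) : graphNorm d z = ‖WithLp.toLp 2 (z, d z)‖ := by
    rw [WithLp.prod_norm_eq_of_L2]
    rfl
  rw [key, key, key, map_add]
  exact norm_add_le (WithLp.toLp 2 (x, d x)) (WithLp.toLp 2 (y, d y))

end GraphNorm

lemma le_of_sq_le_mul_self {x M : ℝ} (hM : 0 ≤ M) (h : x ^ 2 ≤ M * x) : x ≤ M := by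
  by_contra! hx
  nlinarith [mul_pos (hM.trans_lt hx) (sub_pos.2 hx)]

section HodgeLaplace

variable {V0 V1 V2 : Type*}
  [NormedAddCommGroup V0] [InnerProductSpace ℝ V0] [FiniteDimensional ℝ V0]
  [NormedAddCommGroup V1] [InnerProductSpace ℝ V1] [FiniteDimensional ℝ V1]
  [NormedAddCommGroup V2] [InnerProductSpace ℝ V2]

/-- Discrete Hodge decomposition into exact, harmonic and coexact parts. -/
lemma exists_hodge_decomposition (d0 : V0 →ₗ[ℝ] V1) (d1 : V1 →ₗ[ℝ] V2)
    (hd : ∀ τ, d1 (d0 τ) = 0) (u : V1) :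
    ∃ ρ ∈ (LinearMap.ker d0)ᗮ, ∃ h ∈ LinearMap.ker d1 ⊓ (LinearMap.range d0)ᗮ,
      ∃ w ∈ (LinearMap.ker d1)ᗮ, u = d0 ρ + h + w := by
  obtain ⟨k, hk, w, hw, rfl⟩ := (LinearMap.ker d1).exists_add_mem_mem_orthogonal u
  obtain ⟨_, ⟨τ, rfl⟩, h, hh, rfl⟩ := (LinearMap.range d0).exists_add_mem_mem_orthogonal k
  obtain ⟨z, hz, ρ, hρ, rfl⟩ := (LinearMap.ker d0).exists_add_mem_mem_orthogonal τ
  have hz' : d0 z = 0 := hz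
  refine ⟨ρ, hρ, h, ⟨?_, hh⟩, w, hw, by simp [hz']⟩
  simpa [hd] using hk

/-- Stability (inf-sup condition) of the mixed Hodge-Laplace problem: the solution is controlled
by the dual norm `M` of the right-hand side. -/
lemma hodgeLaplace_stability {c M : ℝ} (hc : 0 < c) (hM : 0 ≤ M)
    (d0 : V0 →ₗ[ℝ] V1) (d1 : V1 →ₗ[ℝ] V2) (hd : ∀ τ, d1 (d0 τ) = 0)
    (hP0 : ∀ ρ ∈ (LinearMap.ker d0)ᗮ, graphNorm d0 ρ ≤ c * ‖d0 ρ‖)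
    (hP1 : ∀ v ∈ (LinearMap.ker d1)ᗮ, graphNorm d1 v ≤ c * ‖d1 v‖)
    (s : V0) (u p : V1) (hp : p ∈ LinearMap.ker d1 ⊓ (LinearMap.range d0)ᗮ)
    (hB : ∀ (τ : V0) (v q : V1), q ∈ LinearMap.ker d1 ⊓ (LinearMap.range d0)ᗮ →
      |⟪s, τ⟫ - ⟪d0 τ, u⟫ + ⟪d0 s, v⟫ + ⟪d1 u, d1 v⟫ + ⟪v, p⟫ - ⟪u, q⟫| ≤
        M * (graphNorm d0 τ + graphNorm d1 v + ‖q‖)) :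
    graphNorm d0 s + graphNorm d1 u + ‖p‖ ≤ (2 * c ^ 2 + 5 * c + 5) * M := by
  obtain ⟨ρ, hρ, h, hh, w, hw, hu⟩ := exists_hodge_decomposition d0 d1 hd u
  have hB0 (τ : V0) := hB τ 0 0 (zero_mem _)
  have hB1 (v : V1) := hB 0 v 0 (zero_mem _)
  have hB2 := hB 0 0 h hh
  have g0 : graphNorm d0 (0 : V0) = 0 := by simp [graphNorm]
  have g1 : graphNorm d1 (0 : V1) = 0 := by simp [graphNorm]
  simp only [map_zero, inner_zero_right, inner_zero_left, norm_zero, g0, g1, sub_zero, add_zero,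
    zero_add] at hB0 hB1 hB2
  have hp1 : d1 p = 0 := hp.1
  have hh1 : d1 h = 0 := hh.1
  have hdp (τ : V0) : ⟪d0 τ, p⟫ = 0 := hp.2 _ ⟨τ, rfl⟩
  have hdh (τ : V0) : ⟪d0 τ, h⟫ = 0 := hh.2 _ ⟨τ, rfl⟩
  have hdw (τ : V0) : ⟪d0 τ, w⟫ = 0 := hw _ (hd τ)
  have hhw : ⟪w, h⟫ = 0 := by rw [real_inner_comm]; exact hw _ hh1
  have hpw : ⟪w, p⟫ = 0 := by rw [real_inner_comm]; exact hw _ hp1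
  have hd1u : d1 u = d1 w := by simp [hu, hd, hh1]
  have bp : ‖p‖ ≤ M := by
    have := (le_abs_self _).trans (hB1 p)
    rw [hdp, hp1, inner_zero_right, real_inner_self_eq_norm_sq,
      graphNorm_of_map_eq_zero d1 hp1] at this
    exact le_of_sq_le_mul_self hM (by linarith)
  have bds : ‖d0 s‖ ≤ M := by
    have := (le_abs_self _).trans (hB1 (d0 s))
    rw [hdp, hd, inner_zero_right, real_inner_self_eq_norm_sq,
      graphNorm_of_map_eq_zero d1 (hd s)] at this
    exact le_of_sq_le_mul_self hM (by linarith)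
  have bdw : ‖d1 w‖ ≤ c * M := by
    have := (le_abs_self _).trans (hB1 w)
    rw [hdw, hpw, hd1u, real_inner_self_eq_norm_sq] at this
    exact le_of_sq_le_mul_self (by positivity)
      (by nlinarith [mul_le_mul_of_nonneg_left (hP1 w hw) hM])
  have bw : ‖w‖ ≤ c ^ 2 * M := by
    nlinarith [norm_le_graphNorm d1 w, hP1 w hw, mul_le_mul_of_nonneg_left bdw hc.le]
  have bh : ‖h‖ ≤ M := by
    have : ⟪u, h⟫ = ‖h‖ ^ 2 := by
      rw [hu, inner_add_left, inner_add_left, hdh, hhw, real_inner_self_eq_norm_sq]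
      ring
    rw [zero_sub, abs_neg, this] at hB2
    exact le_of_sq_le_mul_self hM ((le_abs_self _).trans hB2)
  have hdu (τ : V0) : ⟪d0 τ, u⟫ = ⟪d0 τ, d0 ρ⟫ := by
    rw [hu, inner_add_right, inner_add_right, hdh, hdw]
    ring
  have gs : graphNorm d0 s ≤ ‖s‖ + M := (graphNorm_le_add d0 s).trans (by gcongr)
  have bρ : ‖d0 ρ‖ ≤ c * (‖s‖ + M) := by
    have h1 := (neg_le_abs _).trans (hB0 ρ)
    rw [hdu, real_inner_self_eq_norm_sq] at h1
    have h2 := real_inner_le_norm s ρ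
    have h3 := (norm_le_graphNorm d0 ρ).trans (hP0 ρ hρ)
    refine le_of_sq_le_mul_self (by positivity) ?_
    nlinarith [mul_le_mul_of_nonneg_left h3 (norm_nonneg s),
      mul_le_mul_of_nonneg_left (hP0 ρ hρ) hM]
  have bs : ‖s‖ ≤ (c + 2) * M := by
    have h1 := (le_abs_self _).trans (hB0 s)
    rw [hdu, real_inner_self_eq_norm_sq] at h1
    have h2 : ⟪d0 s, d0 ρ⟫ ≤ M * (c * (‖s‖ + M)) := (real_inner_le_norm _ _).trans (by gcongr)
    have h3 := mul_le_mul_of_nonneg_left gs hM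
    by_contra! hlt
    nlinarith [mul_nonneg hM hM, mul_nonneg hc.le (mul_nonneg hM hM),
      mul_pos ((show 0 ≤ (c + 2) * M by positivity).trans_lt hlt) (sub_pos.2 hlt),
      mul_nonneg hM (sub_pos.2 hlt).le]
  have bρ' : ‖d0 ρ‖ ≤ c * (c + 3) * M := by
    nlinarith [mul_le_mul_of_nonneg_left bs hc.le]
  have bu : ‖u‖ ≤ ‖d0 ρ‖ + ‖h‖ + ‖w‖ := by rw [hu]; exact norm_add₃_le
  have gu := graphNorm_le_add d1 u
  rw [hd1u] at gu
  linarith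

end HodgeLaplace

/-- Error estimate between the DEC and FEEC discrete solutions of the mixed
Hodge-Laplace problem, in abstract form: the constants `C'` and `ε₀` depend
only on the Poincaré constant `c_P`. -/
theorem dec_feec_solution_error_abstract (c_P : ℝ) (hc_P : 0 < c_P) :
    ∃ C' > (0 : ℝ), ∃ ε₀ > (0 : ℝ),
      ∀ (V0 V1 V2 : Type)
        [inst0 : NormedAddCommGroup V0] [inst0' : InnerProductSpace ℝ V0]
        [inst0'' : FiniteDimensional ℝ V0]
        [inst1 : NormedAddCommGroup V1] [inst1' : InnerProductSpace ℝ V1]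
        [inst1'' : FiniteDimensional ℝ V1]
        [inst2 : NormedAddCommGroup V2] [inst2' : InnerProductSpace ℝ V2]
        [inst2'' : FiniteDimensional ℝ V2]
        (d0 : V0 →ₗ[ℝ] V1) (d1 : V1 →ₗ[ℝ] V2),
        (∀ τ : V0, d1 (d0 τ) = 0) →
        -- Poincaré inequalities with constant c_P
        (∀ ρ ∈ (LinearMap.ker d0)ᗮ,
          Real.sqrt (‖ρ‖ ^ 2 + ‖d0 ρ‖ ^ 2) ≤ c_P * ‖d0 ρ‖) →
        (∀ v ∈ (LinearMap.ker d1)ᗮ,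
          Real.sqrt (‖v‖ ^ 2 + ‖d1 v‖ ^ 2) ≤ c_P * ‖d1 v‖) →
        ∀ (D0 : V0 →ₗ[ℝ] V0 →ₗ[ℝ] ℝ) (D1 : V1 →ₗ[ℝ] V1 →ₗ[ℝ] ℝ)
          (D2 : V2 →ₗ[ℝ] V2 →ₗ[ℝ] ℝ),
        (∀ u w : V0, D0 u w = D0 w u) → (∀ u : V0, u ≠ 0 → 0 < D0 u u) →
        (∀ u w : V1, D1 u w = D1 w u) → (∀ u : V1, u ≠ 0 → 0 < D1 u u) →
        (∀ u w : V2, D2 u w = D2 w u) → (∀ u : V2, u ≠ 0 → 0 < D2 u u) →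
        ∀ ε : ℝ, 0 ≤ ε →
        -- consistency of the bilinear forms with the inner products
        (∀ u w : V0, |D0 u w - ⟪u, w⟫| ≤
          ε * Real.sqrt (‖u‖ ^ 2 + ‖d0 u‖ ^ 2) * Real.sqrt (‖w‖ ^ 2 + ‖d0 w‖ ^ 2)) →
        (∀ u w : V1, |D1 u w - ⟪u, w⟫| ≤
          ε * Real.sqrt (‖u‖ ^ 2 + ‖d1 u‖ ^ 2) * Real.sqrt (‖w‖ ^ 2 + ‖d1 w‖ ^ 2)) →
        (∀ u w : V2, |D2 u w - ⟪u, w⟫| ≤ ε * ‖u‖ * ‖w‖) →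
        ε ≤ ε₀ →
        ∀ (f : V1) (σ : V0) (u p : V1) (σh : V0) (uh ph : V1),
          p ∈ LinearMap.ker d1 ⊓ (LinearMap.range d0)ᗮ →
          ph ∈ LinearMap.ker d1 ⊓ (LinearMap.range d0)ᗮ →
          -- (σ, u, p) is the FEEC solution
          (∀ (τ : V0) (v q : V1), q ∈ LinearMap.ker d1 ⊓ (LinearMap.range d0)ᗮ →
            ⟪σ, τ⟫ - ⟪d0 τ, u⟫ + ⟪d0 σ, v⟫ + ⟪d1 u, d1 v⟫ + ⟪v, p⟫ - ⟪u, q⟫ = ⟪f, v⟫) →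
          -- (σh, uh, ph) is the DEC solution
          (∀ (τ : V0) (v q : V1), q ∈ LinearMap.ker d1 ⊓ (LinearMap.range d0)ᗮ →
            D0 σh τ - D1 (d0 τ) uh + D1 (d0 σh) v + D2 (d1 uh) (d1 v) + D1 v ph - D1 uh q
              = D1 f v) →
          Real.sqrt (‖σh - σ‖ ^ 2 + ‖d0 (σh - σ)‖ ^ 2)
              + Real.sqrt (‖uh - u‖ ^ 2 + ‖d1 (uh - u)‖ ^ 2) + ‖ph - p‖
            ≤ C' * ε * (Real.sqrt (‖σ‖ ^ 2 + ‖d0 σ‖ ^ 2)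
              + Real.sqrt (‖u‖ ^ 2 + ‖d1 u‖ ^ 2) + ‖p‖
              + Real.sqrt (‖f‖ ^ 2 + ‖d1 f‖ ^ 2)) := by
  set K : ℝ := 2 * c_P ^ 2 + 5 * c_P + 5 with hK
  have hKpos : 0 < K := by positivity
  refine ⟨2 * K, by positivity, 1 / (2 * K), by positivity, ?_⟩
  intro V0 V1 V2 _ _ _ _ _ _ _ _ _ d0 d1 hd hP0 hP1 D0 D1 D2 _ _ _ _ _ _ ε hε hD0 hD1 hD2 hε₀
    f σ u p σh uh ph hp hph hF hD
  simp only [← graphNorm_def] at hP0 hP1 hD0 hD1 ⊢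
  have hpV {q : V1} (hq : q ∈ LinearMap.ker d1 ⊓ (LinearMap.range d0)ᗮ) :
      graphNorm d1 q = ‖q‖ := graphNorm_of_map_eq_zero d1 hq.1
  have hdV (τ : V0) : graphNorm d1 (d0 τ) = ‖d0 τ‖ := graphNorm_of_map_eq_zero d1 (hd τ)
  have nonneg0 := graphNorm_nonneg d0
  have nonneg1 := graphNorm_nonneg d1
  set S := graphNorm d0 σh + graphNorm d1 uh + ‖ph‖ + graphNorm d1 f with hS
  have hS0 : 0 ≤ S := by
    linarith [nonneg0 σh, nonneg1 uh, nonneg1 f, norm_nonneg ph]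
  have stab := hodgeLaplace_stability hc_P (mul_nonneg hε hS0) d0 d1 hd hP0 hP1
    (σh - σ) (uh - u) (ph - p) (sub_mem hph hp) (by
      intro τ v q hq
      have e0 := abs_le.1 (hD0 σh τ)
      have e1 := abs_le.1 (hD1 (d0 τ) uh)
      have e2 := abs_le.1 (hD1 (d0 σh) v)
      have e3 := abs_le.1 (hD2 (d1 uh) (d1 v))
      have e4 := abs_le.1 (hD1 v ph)
      have e5 := abs_le.1 (hD1 uh q)
      have e6 := abs_le.1 (hD1 f v)
      rw [hdV] at e1 e2
      rw [hpV hph] at e4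
      rw [hpV hq] at e5
      have eF := hF τ v q hq
      have eD := hD τ v q hq
      have total : ε * graphNorm d0 σh * graphNorm d0 τ + ε * ‖d0 τ‖ * graphNorm d1 uh
          + ε * ‖d0 σh‖ * graphNorm d1 v + ε * ‖d1 uh‖ * ‖d1 v‖ + ε * graphNorm d1 v * ‖ph‖
          + ε * graphNorm d1 uh * ‖q‖ + ε * graphNorm d1 f * graphNorm d1 v
          ≤ ε * S * (graphNorm d0 τ + graphNorm d1 v + ‖q‖) := by
        calc
          _ ≤ ε * graphNorm d0 σh * graphNorm d0 τ + ε * graphNorm d0 τ * graphNorm d1 uh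
              + ε * graphNorm d0 σh * graphNorm d1 v + ε * graphNorm d1 uh * graphNorm d1 v
              + ε * graphNorm d1 v * ‖ph‖
              + ε * graphNorm d1 uh * ‖q‖ + ε * graphNorm d1 f * graphNorm d1 v := by
            gcongr <;> first
              | exact norm_map_le_graphNorm _ _
              | exact nonneg1 _
              | exact mul_nonneg hε (nonneg1 _)
          _ ≤ ε * graphNorm d0 σh * graphNorm d0 τ + ε * graphNorm d0 τ * graphNorm d1 uh
              + ε * graphNorm d0 σh * graphNorm d1 v + ε * graphNorm d1 uh * graphNorm d1 v
              + ε * graphNorm d1 v * ‖ph‖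
              + ε * graphNorm d1 uh * ‖q‖ + ε * graphNorm d1 f * graphNorm d1 v
              + ε * (graphNorm d0 σh * ‖q‖ + ‖ph‖ * graphNorm d0 τ + ‖ph‖ * ‖q‖
                + graphNorm d1 f * graphNorm d0 τ + graphNorm d1 f * ‖q‖) := by
            have := nonneg0 σh
            have := nonneg0 τ
            have := nonneg1 f
            exact le_add_of_nonneg_right (by positivity)
          _ = _ := by rw [hS]; ring
      simp only [map_sub, inner_sub_left, inner_sub_right]
      rw [abs_le]
      constructor <;> linarith)
  rw [← hK] at stab
  have tσ : graphNorm d0 σh ≤ graphNorm d0 (σh - σ) + graphNorm d0 σ := by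
    simpa using graphNorm_add_le d0 (σh - σ) σ
  have tu : graphNorm d1 uh ≤ graphNorm d1 (uh - u) + graphNorm d1 u := by
    simpa using graphNorm_add_le d1 (uh - u) u
  have tp : ‖ph‖ ≤ ‖ph - p‖ + ‖p‖ := by simpa using norm_add_le (ph - p) p
  set E := graphNorm d0 (σh - σ) + graphNorm d1 (uh - u) + ‖ph - p‖
  set T := graphNorm d0 σ + graphNorm d1 u + ‖p‖ + graphNorm d1 f
  have hE0 : 0 ≤ E := add_nonneg (add_nonneg (nonneg0 _) (nonneg1 _)) (norm_nonneg _)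
  have hST : S ≤ E + T := by linarith
  have hKε : K * ε ≤ 1 / 2 := by
    calc K * ε ≤ K * (1 / (2 * K)) := by gcongr
      _ = 1 / 2 := by field_simp
  have h1 : K * ε * S ≤ K * ε * (E + T) := by gcongr
  have h2 : K * ε * E ≤ 1 / 2 * E := by gcongr
  linarith
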